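/- arXiv:math/0407448 — 2 statements merged into one kernel-verified Lean document; each statement's English description precedes it below -/
import Mathlib

section
/- Let m and k be integers with 1 ≤ k ≤ m. Let p be a real polynomial of degree at most 2m−k−1 and q a real polynomial of degree at most k−1. If t₁, …, t_m are distinct numbers in (0,1) such that for every i with 1 ≤ i ≤ m both p^{even}(t_i) + q^{odd}(t_i)(1−t_i²)^{m−k} = 0 and p^{odd}(t_i) + q^{even}(t_i)(1−t_i²)^{m−k} = 0, then p is the zero polynomial and q is the zero polynomial. -/
open Real Finset

/-- The even part of a real polynomial `p(t) = ∑ⱼ aⱼ tʲ`, i.e. `∑_{j even} aⱼ tʲ`. -/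
noncomputable def evenPart (p : Polynomial ℝ) : Polynomial ℝ :=
  Polynomial.C (1 / 2) * (p + p.comp (-Polynomial.X))

/-- The odd part of a real polynomial `p(t) = ∑ⱼ aⱼ tʲ`, i.e. `∑_{j odd} aⱼ tʲ`. -/
noncomputable def oddPart (p : Polynomial ℝ) : Polynomial ℝ :=
  Polynomial.C (1 / 2) * (p - p.comp (-Polynomial.X))

/-- Every polynomial splits as `E(X²) + X O(X²)`, with the expected degree bounds. -/
lemma exists_even_odd_decomposition {R : Type*} [CommRing R] (p : Polynomial R) :
    ∃ E O : Polynomial R,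
      (∀ x, p.eval x = E.eval (x ^ 2) + x * O.eval (x ^ 2)) ∧
      (p = Polynomial.expand R 2 E + Polynomial.X * Polynomial.expand R 2 O) ∧
      (∀ n, p.natDegree < 2 * n → E.degree < n) ∧
      (∀ n, p.natDegree < 2 * n + 1 → O.degree < n) := by
  have key : p = Polynomial.expand R 2 (p.contract 2) +
      Polynomial.X * Polynomial.expand R 2 (p.divX.contract 2) := by
    ext (_ | n)
    · simp [Polynomial.coeff_expand, Polynomial.coeff_contract]
    · rw [Polynomial.coeff_add, Polynomial.coeff_X_mul, Polynomial.coeff_expand two_pos,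
        Polynomial.coeff_expand two_pos, Polynomial.coeff_contract two_ne_zero,
        Polynomial.coeff_contract two_ne_zero, Polynomial.coeff_divX]
      rcases Nat.even_or_odd' n with ⟨c, rfl | rfl⟩
      · rw [if_neg (by omega), if_pos (by omega), zero_add]
        congr 1
        omega
      · rw [if_pos (by omega), if_neg (by omega), add_zero]
        congr 1
        omega
  refine ⟨p.contract 2, p.divX.contract 2, fun x => ?_, key, fun n hn => ?_, fun n hn => ?_⟩
  · conv_lhs => rw [key]
    simp [Polynomial.expand_eval]
  · rw [Polynomial.degree_lt_iff_coeff_zero]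
    intro j hj
    rw [Polynomial.coeff_contract two_ne_zero]
    exact Polynomial.coeff_eq_zero_of_natDegree_lt (by omega)
  · rw [Polynomial.degree_lt_iff_coeff_zero]
    intro j hj
    rw [Polynomial.coeff_contract two_ne_zero, Polynomial.coeff_divX]
    exact Polynomial.coeff_eq_zero_of_natDegree_lt (by omega)

/-- The divided difference of a polynomial of degree less than `#s - 1` vanishes
(at nonzero nodes). -/
lemma sum_nodalWeight_mul_eval_eq_zero {ι F : Type*} [DecidableEq ι] [Field F] {s : Finset ι}
    {v : ι → F} (hv : Set.InjOn v s) (h0 : ∀ i ∈ s, v i ≠ 0) {D : Polynomial F}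
    (hD : (Polynomial.X * D).degree < (#s : WithBot ℕ)) :
    ∑ i ∈ s, Lagrange.nodalWeight s v i * D.eval (v i) = 0 := by
  have hx : ∀ i ∈ s, (0 : F) ≠ v i := fun i hi => (h0 i hi).symm
  have h := congrArg (Polynomial.eval 0) (Lagrange.eq_interpolate hv hD)
  rw [Lagrange.eval_interpolate_not_at_node _ hx] at h
  have h' := (mul_eq_zero.mp (h.symm.trans (by simp))).resolve_left
    (Lagrange.eval_nodal_not_at_node hx)
  rw [← neg_eq_zero, ← h', ← Finset.sum_neg_distrib]
  refine Finset.sum_congr rfl fun i hi => ?_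
  have := h0 i hi
  simp only [Polynomial.eval_mul, Polynomial.eval_X, zero_sub, inv_neg]
  field_simp

/-- If the divided difference of `R(y) / √y` at the nodes `tᵢ²` vanishes and `R` is nonnegative on
the negative half-line, then `R` vanishes there. The antiderivative of
`R(-u²) / ∏ (u² + tᵢ²)` is a combination of arctangents with limit zero at `±∞`. -/
lemma eval_neg_sq_eq_zero_of_sum_nodalWeight_eq_zero {ι : Type*} [DecidableEq ι] {s : Finset ι}
    {t : ι → ℝ} (ht : Set.InjOn (fun i => t i ^ 2) s) (ht0 : ∀ i ∈ s, 0 < t i)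
    {R : Polynomial ℝ} (hR : R.degree < #s)
    (hsum : ∑ i ∈ s, Lagrange.nodalWeight s (fun i => t i ^ 2) i * R.eval (t i ^ 2) / t i = 0)
    (hnonneg : ∀ u : ℝ, 0 ≤ R.eval (-u ^ 2)) (u : ℝ) : R.eval (-u ^ 2) = 0 := by
  set c : ι → ℝ := fun i => Lagrange.nodalWeight s (fun i => t i ^ 2) i * R.eval (t i ^ 2)
  set ε : ℝ := (-1) ^ #s
  have hε : ε * ε = 1 := by rw [← mul_pow]; simp
  have hQ : ∀ u : ℝ, 0 < ∏ i ∈ s, (u ^ 2 + t i ^ 2) := fun u =>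
    Finset.prod_pos fun i hi => by have := ht0 i hi; positivity
  have hval : ∀ u : ℝ, R.eval (-u ^ 2) =
      (∏ i ∈ s, (u ^ 2 + t i ^ 2)) * (-ε * ∑ i ∈ s, c i / (u ^ 2 + t i ^ 2)) := by
    intro u
    have hx : ∀ i ∈ s, -u ^ 2 ≠ t i ^ 2 := fun i hi => by
      have := ht0 i hi
      have : 0 < t i ^ 2 := by positivity
      nlinarith [sq_nonneg u]
    have h := congrArg (Polynomial.eval (-u ^ 2)) (Lagrange.eq_interpolate ht hR)
    rw [Lagrange.eval_interpolate_not_at_node _ hx, Lagrange.eval_nodal] at h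
    have hN : ∏ i ∈ s, (-u ^ 2 - t i ^ 2) = ε * ∏ i ∈ s, (u ^ 2 + t i ^ 2) := by
      rw [show ε = ∏ i ∈ s, (-1 : ℝ) from (Finset.prod_const _).symm, ← Finset.prod_mul_distrib]
      exact Finset.prod_congr rfl fun i _ => by ring
    have hS : ∑ i ∈ s, Lagrange.nodalWeight s (fun i => t i ^ 2) i * (-u ^ 2 - t i ^ 2)⁻¹ *
        R.eval (t i ^ 2) = -∑ i ∈ s, c i / (u ^ 2 + t i ^ 2) := by
      rw [← Finset.sum_neg_distrib]
      refine Finset.sum_congr rfl fun i _ => ?_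
      rw [show -u ^ 2 - t i ^ 2 = -(u ^ 2 + t i ^ 2) by ring, inv_neg]
      simp only [c]
      ring
    rw [h, hN, hS]
    ring
  set K : ℝ → ℝ := fun u => -ε * ∑ i ∈ s, c i / t i * arctan (u / t i) with hK
  have hderiv : ∀ u, HasDerivAt K (-ε * ∑ i ∈ s, c i / (u ^ 2 + t i ^ 2)) u := by
    intro u
    refine HasDerivAt.const_mul _ (HasDerivAt.fun_sum fun i hi => ?_)
    have := ht0 i hi
    refine (((hasDerivAt_id u).div_const (t i)).arctan.const_mul (c i / t i)).congr_deriv ?_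
    simp only [id]
    field_simp
    ring
  have hmono : Monotone K := monotone_of_hasDerivAt_nonneg hderiv fun u =>
    nonneg_of_mul_nonneg_right ((hval u).symm ▸ hnonneg u) (hQ u)
  have htop : Filter.Tendsto K Filter.atTop (nhds 0) := by
    have : Filter.Tendsto K Filter.atTop (nhds (-ε * ∑ i ∈ s, c i / t i * (π / 2))) :=
      (tendsto_finsetSum _ fun i hi => (((tendsto_arctan_atTop.mono_right nhdsWithin_le_nhds).comp
        (Filter.tendsto_id.atTop_div_const (ht0 i hi))).const_mul _)).const_mul _
    rwa [← Finset.sum_mul, hsum, zero_mul, mul_zero] at this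
  have hbot : Filter.Tendsto K Filter.atBot (nhds 0) := by
    have : Filter.Tendsto K Filter.atBot (nhds (-ε * ∑ i ∈ s, c i / t i * (-(π / 2)))) :=
      (tendsto_finsetSum _ fun i hi => (((tendsto_arctan_atBot.mono_right nhdsWithin_le_nhds).comp
        (Filter.tendsto_id.atBot_div_const (ht0 i hi))).const_mul _)).const_mul _
    rwa [← Finset.sum_mul, hsum, zero_mul, mul_zero] at this
  have hzero : K = fun _ => 0 :=
    funext fun u => le_antisymm (hmono.ge_of_tendsto htop u) (hmono.le_of_tendsto hbot u)
  have hu := hderiv u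
  rw [hzero] at hu
  rw [hval, hu.unique (hasDerivAt_const u 0), mul_zero]

/-- A real polynomial with `p(-u²) = 0` for all `u > 0` is zero. -/
lemma eq_zero_of_eval_neg_sq_eq_zero {p : Polynomial ℝ}
    (h : ∀ u : ℝ, 0 < u → p.eval (-u ^ 2) = 0) : p = 0 := by
  refine Polynomial.eq_zero_of_infinite_isRoot p ((Set.Iio_infinite (0 : ℝ)).mono fun x hx => ?_)
  have hx' : 0 < -x := neg_pos.mpr hx
  have := h (√(-x)) (Real.sqrt_pos.mpr hx')
  rwa [Real.sq_sqrt hx'.le, neg_neg] at this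

/-- Proposition 2.5/`prop:2`: Let `1 ≤ k ≤ m`, let `p` be a real
polynomial of degree at most `2m-k-1` and `q` of degree at most `k-1`.  If
`t₁, …, t_m` are distinct points of `(0,1)` with
`p^even(tᵢ) + q^odd(tᵢ)(1-tᵢ²)^{m-k} = 0` and
`p^odd(tᵢ) + q^even(tᵢ)(1-tᵢ²)^{m-k} = 0` for all `i`, then `p = 0` and `q = 0`. -/
theorem statement4 (m k : ℕ) (hk1 : 1 ≤ k) (hkm : k ≤ m)
    (p q : Polynomial ℝ)
    (hp : p.natDegree ≤ 2 * m - k - 1) (hq : q.natDegree ≤ k - 1)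
    (t : Fin m → ℝ) (ht : Function.Injective t)
    (ht01 : ∀ i, t i ∈ Set.Ioo (0 : ℝ) 1)
    (h1 : ∀ i, (evenPart p).eval (t i) + (oddPart q).eval (t i) * (1 - t i ^ 2) ^ (m - k) = 0)
    (h2 : ∀ i, (oddPart p).eval (t i) + (evenPart q).eval (t i) * (1 - t i ^ 2) ^ (m - k) = 0) :
    p = 0 ∧ q = 0 := by
  have hev : ∀ (f : Polynomial ℝ) (x : ℝ),
      (evenPart f).eval x = 1 / 2 * (f.eval x + f.eval (-x)) := by
    simp [evenPart, Polynomial.eval_comp]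
  have hod : ∀ (f : Polynomial ℝ) (x : ℝ),
      (oddPart f).eval x = 1 / 2 * (f.eval x - f.eval (-x)) := by
    simp [oddPart, Polynomial.eval_comp]
  have hpos : ∀ i, p.eval (t i) = -(q.eval (t i) * (1 - t i ^ 2) ^ (m - k)) := fun i => by
    have a := h1 i
    have b := h2 i
    rw [hev, hod] at a b
    linarith
  have hneg : ∀ i, p.eval (-t i) = q.eval (-t i) * (1 - t i ^ 2) ^ (m - k) := fun i => by
    have a := h1 i
    have b := h2 i
    rw [hev, hod] at a b
    linarith
  have ht0 : ∀ i, 0 < t i := fun i => (ht01 i).1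
  have hy : Function.Injective fun i => t i ^ 2 := fun i j hij =>
    ht ((pow_left_inj₀ (ht0 i).le (ht0 j).le two_ne_zero).mp hij)
  have hm : #(Finset.univ : Finset (Fin m)) = m := Finset.card_fin m
  have hq0 : q = 0 := by
    obtain ⟨E, O, hqe, hqx, -, -⟩ := exists_even_odd_decomposition q
    obtain ⟨A, D, hS, -, -, hD⟩ := exists_even_odd_decomposition (p * q.comp (-Polynomial.X))
    have hcomp : (q.comp (-Polynomial.X)).natDegree = q.natDegree := by
      simp [Polynomial.natDegree_comp]
    have hF : (E ^ 2 - Polynomial.X * O ^ 2).natDegree ≤ k - 1 := by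
      have hex : Polynomial.expand ℝ 2 (E ^ 2 - Polynomial.X * O ^ 2) =
          q * q.comp (-Polynomial.X) := by
        refine Polynomial.funext fun x => ?_
        simp only [Polynomial.expand_eval, Polynomial.eval_sub, Polynomial.eval_mul,
          Polynomial.eval_pow, Polynomial.eval_X, Polynomial.eval_comp, Polynomial.eval_neg, hqe,
          neg_sq]
        ring
      have h := Polynomial.natDegree_mul_le (p := q) (q := q.comp (-Polynomial.X))
      rw [← hex, Polynomial.natDegree_expand, hcomp] at h
      omega
    set R : Polynomial ℝ :=
      (E ^ 2 - Polynomial.X * O ^ 2) * (1 - Polynomial.X) ^ (m - k) with hRdef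
    have hRdeg : R.degree < #(Finset.univ : Finset (Fin m)) := by
      have h1X : ((1 : Polynomial ℝ) - Polynomial.X).natDegree ≤ 1 :=
        (Polynomial.natDegree_sub_le _ _).trans (by simp)
      have h : R.natDegree ≤ (k - 1) + (m - k) * 1 := Polynomial.natDegree_mul_le_of_le hF
        (Polynomial.natDegree_pow_le_of_le _ h1X)
      rw [hm]
      exact Polynomial.degree_le_natDegree.trans_lt (by exact_mod_cast (by omega))
    have hRt : ∀ i, R.eval (t i ^ 2) = -(t i * D.eval (t i ^ 2)) := by
      intro i
      have a := hS (t i)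
      have b := hS (-t i)
      simp only [Polynomial.eval_mul, Polynomial.eval_comp, Polynomial.eval_neg, Polynomial.eval_X,
        neg_neg, neg_sq, hpos, hneg] at a b
      have hR : R.eval (t i ^ 2) = q.eval (t i) * q.eval (-t i) * (1 - t i ^ 2) ^ (m - k) := by
        simp only [hRdef, Polynomial.eval_sub, Polynomial.eval_mul, Polynomial.eval_pow,
          Polynomial.eval_X, Polynomial.eval_one, hqe, neg_sq]
        ring
      rw [hR]
      linarith
    have hXD : (Polynomial.X * D).degree < (#(Finset.univ : Finset (Fin m)) : WithBot ℕ) := by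
      have h := Polynomial.natDegree_mul_le (p := p) (q := q.comp (-Polynomial.X))
      rw [hcomp] at h
      have hD' := hD (m - 1) (by omega)
      rw [Polynomial.degree_lt_iff_coeff_zero] at hD' ⊢
      rw [hm]
      rintro (_ | j) hj
      · simp
      · rw [Polynomial.coeff_X_mul]
        exact hD' j (by omega)
    have hRu : ∀ u : ℝ, R.eval (-u ^ 2) =
        (E.eval (-u ^ 2) ^ 2 + (u * O.eval (-u ^ 2)) ^ 2) * (1 + u ^ 2) ^ (m - k) := by
      intro u
      simp only [hRdef, Polynomial.eval_sub, Polynomial.eval_mul, Polynomial.eval_pow,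
        Polynomial.eval_X, Polynomial.eval_one]
      rw [sub_neg_eq_add]
      ring
    have hzero := eval_neg_sq_eq_zero_of_sum_nodalWeight_eq_zero hy.injOn (fun i _ => ht0 i) hRdeg
      (by
        rw [← neg_eq_zero, ← sum_nodalWeight_mul_eval_eq_zero hy.injOn
          (fun i _ => pow_ne_zero 2 (ht0 i).ne') hXD, ← Finset.sum_neg_distrib]
        refine Finset.sum_congr rfl fun i _ => ?_
        have := (ht0 i).ne'
        rw [hRt]
        field_simp)
      (fun u => by rw [hRu]; positivity)
    have hsq : ∀ u : ℝ, E.eval (-u ^ 2) ^ 2 + (u * O.eval (-u ^ 2)) ^ 2 = 0 := fun u =>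
      (mul_eq_zero.mp ((hRu u).symm.trans (hzero u))).resolve_right (by positivity)
    have hE : E = 0 := eq_zero_of_eval_neg_sq_eq_zero fun u _ => by
      exact pow_eq_zero_iff two_ne_zero |>.mp
        (le_antisymm (by linarith [hsq u, sq_nonneg (u * O.eval (-u ^ 2))]) (sq_nonneg _))
    have hO : O = 0 := eq_zero_of_eval_neg_sq_eq_zero fun u hu => by
      have := hsq u
      rw [hE] at this
      simpa [hu.ne'] using this
    rw [hqx, hE, hO]
    simp
  refine ⟨?_, hq0⟩
  obtain ⟨E, O, hpe, hpx, hEd, hOd⟩ := exists_even_odd_decomposition p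
  have a : ∀ i, E.eval (t i ^ 2) + t i * O.eval (t i ^ 2) = 0 := fun i => by
    rw [← hpe, hpos, hq0]
    simp
  have b : ∀ i, E.eval (t i ^ 2) - t i * O.eval (t i ^ 2) = 0 := fun i => by
    have h := hpe (-t i)
    rw [hneg, hq0] at h
    simp only [Polynomial.eval_zero, zero_mul, neg_sq] at h
    linarith
  have hE : E = 0 := Polynomial.eq_zero_of_degree_lt_of_eval_index_eq_zero hy.injOn
    (s := Finset.univ) (by rw [hm]; exact hEd m (by omega)) fun i _ => by linarith [a i, b i]
  have hO : O = 0 := Polynomial.eq_zero_of_degree_lt_of_eval_index_eq_zero hy.injOn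
    (s := Finset.univ) (by rw [hm]; exact hOd m (by omega)) fun i _ =>
      (mul_eq_zero.mp (by linarith [a i, b i] : t i * O.eval (t i ^ 2) = 0)).resolve_left
        (ht0 i).ne'
  rw [hpx, hE, hO]
  simp
end

section
/- Let r and s be integers with r > s > 0. For 0 ≤ k ≤ s−1 and 0 ≤ j ≤ r−s define a_{k,j} = C(r−s, j) · ∏_{i=0}^{j}(2k+2i+1) · ∏_{i=j}^{r−s}(2(r−k−i)−1), where C(·,·) is the binomial coefficient, and define the polynomial h_k(t) = Σ_{j=0}^{r−s} a_{k,j} t^{j+k}. Then {h₀, h₁, …, h_{s−1}} is a Chebyshev system on (0,1): if real numbers c₀, …, c_{s−1} are such that Σ_{k=0}^{s−1} c_k h_k vanishes at s distinct points of (0,1), then c₀ = … = c_{s−1} = 0. Equivalently, for any distinct t₁, …, t_s ∈ (0,1) the s×s matrix (h_j(t_{k}))_{j=0,…,s−1; k=1,…,s} is invertible. -/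
open Real Finset

open Polynomial in
/-- The coefficient sequence of `f` has a subsequence of length `v + 1` of strictly alternating
sign, i.e. at least `v` sign changes. -/
def HasAlternation (f : ℝ[X]) (v : ℕ) : Prop :=
  ∃ (ε : ℝ) (idx : ℕ → ℕ), (∀ j < v, idx j < idx (j + 1)) ∧
    ∀ j ≤ v, 0 < ε * (-1) ^ j * f.coeff (idx j)

namespace HasAlternation

open Polynomial

variable {f g : ℝ[X]} {v : ℕ}

theorem le_natDegree (hf : HasAlternation f v) : v ≤ f.natDegree := by
  obtain ⟨ε, idx, hidx, hpos⟩ := hf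
  have hle : ∀ j ≤ v, j ≤ idx j := by
    intro j
    induction j with
    | zero => simp
    | succ j ih =>
      intro hj
      have := ih (by omega)
      have := hidx j (by omega)
      omega
  refine (hle v le_rfl).trans (le_natDegree_of_ne_zero fun h0 => ?_)
  simpa [h0] using hpos v le_rfl

theorem of_coeff_eq_mul {w : ℕ → ℝ} (hw : ∀ m, 0 < w m) (hfg : ∀ m, f.coeff m = w m * g.coeff m)
    (hf : HasAlternation f v) : HasAlternation g v := by
  obtain ⟨ε, idx, hidx, hpos⟩ := hf
  refine ⟨ε, idx, hidx, fun j hj => pos_of_mul_pos_right (a := w (idx j)) ?_ (hw _).le⟩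
  have := hpos j hj
  rw [hfg] at this
  linarith

theorem of_one_add_X_mul (hf : HasAlternation ((1 + X) * f) v) : HasAlternation f v := by
  obtain ⟨ε, idx, hidx, hpos⟩ := hf
  have hex : ∀ j, ∃ i, i ≤ idx j ∧ idx j ≤ i + 1 ∧ (j ≤ v → 0 < ε * (-1) ^ j * f.coeff i) := by
    intro j
    by_cases hj : j ≤ v
    · have hp := hpos j hj
      rcases hm : idx j with _ | m
      · refine ⟨0, le_rfl, by omega, fun _ => ?_⟩
        simpa [hm, add_mul] using hp
      · rw [hm, add_mul, one_mul, coeff_add, coeff_X_mul, mul_add] at hp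
        rcases lt_or_ge 0 (ε * (-1) ^ j * f.coeff (m + 1)) with h1 | h1
        · exact ⟨m + 1, le_rfl, by omega, fun _ => h1⟩
        · exact ⟨m, by omega, le_rfl, fun _ => by linarith⟩
    · exact ⟨idx j, le_rfl, by omega, fun h => absurd h hj⟩
  choose i hi1 hi2 hi3 using hex
  refine ⟨ε, i, fun j hj => ?_, hi3⟩
  have h1 := hi1 j
  have h2 := hi2 (j + 1)
  have h3 := hidx j hj
  refine lt_of_le_of_ne (by omega) fun heq => ?_
  have h4 := hi3 j hj.le
  have h5 := hi3 (j + 1) hj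
  rw [← heq, pow_succ] at h5
  linarith

theorem of_one_add_X_pow_mul {n : ℕ} (hf : HasAlternation ((1 + X) ^ n * f) v) :
    HasAlternation f v := by
  induction n with
  | zero => simpa using hf
  | succ n ih => exact ih (of_one_add_X_mul (by rwa [pow_succ', mul_assoc] at hf))

theorem exists_pos_sub {G : ℕ → ℝ} {a b : ℕ} (hab : a ≤ b) (h : 0 < G b - G a) :
    ∃ m, a ≤ m ∧ m < b ∧ 0 < G (m + 1) - G m := by
  by_contra! hcon
  rw [← Finset.sum_Ico_sub G hab] at h
  refine h.not_ge (Finset.sum_nonpos fun m hm => ?_)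
  rw [Finset.mem_Ico] at hm
  exact hcon m hm.1 hm.2

theorem X_sub_C_mul {η : ℝ} (hη : 0 < η) (hg : HasAlternation g v) :
    HasAlternation ((X - C η) * g) (v + 1) := by
  obtain ⟨ε, idx, hidx, hpos⟩ := hg
  set G : ℕ → ℝ := fun m => η ^ m * (X * g).coeff m with hG
  have hGsub : ∀ m, G (m + 1) - G m = -(η ^ m * ((X - C η) * g).coeff m) := by
    intro m
    simp only [hG, sub_mul, coeff_sub, coeff_X_mul, coeff_C_mul]
    ring
  have hGpos : ∀ j ≤ v, 0 < ε * (-1) ^ j * G (idx j + 1) := by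
    intro j hj
    have := mul_pos (pow_pos hη (idx j + 1)) (hpos j hj)
    simp only [hG, coeff_X_mul]
    linarith
  -- Between consecutive points of `0, idx 0 + 1, …, idx v + 1, ∞` the sequence `G` moves in
  -- alternating directions.
  have hstep : ∀ j, ∃ a b, a < b ∧ (j ≤ v → b = idx j + 1) ∧
      (1 ≤ j → j ≤ v + 1 → a = idx (j - 1) + 1) ∧
      (j ≤ v + 1 → 0 < ε * (-1) ^ j * G b - ε * (-1) ^ j * G a) := by
    intro j
    rcases j with _ | j
    · refine ⟨0, idx 0 + 1, by omega, fun _ => rfl, by omega, fun _ => ?_⟩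
      simpa [hG] using hGpos 0 (by omega)
    · rcases lt_trichotomy j v with hj | hj | hj
      · refine ⟨idx j + 1, idx (j + 1) + 1, ?_, fun _ => rfl, fun _ _ => rfl, fun _ => ?_⟩
        · have := hidx j hj
          omega
        · have h1 := hGpos j hj.le
          have h2 := hGpos (j + 1) hj
          rw [pow_succ] at h2 ⊢
          linarith
      · refine ⟨idx j + 1, idx j + g.natDegree + 2, by omega, by omega, fun _ _ => rfl,
          fun _ => ?_⟩
        have h1 := hGpos j hj.le
        have h2 : G (idx j + g.natDegree + 2) = 0 := by
          simp only [hG, coeff_X_mul]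
          rw [coeff_eq_zero_of_natDegree_lt (by omega), mul_zero]
        rw [h2, pow_succ]
        linarith
      · exact ⟨0, 1, by omega, by omega, by omega, by omega⟩
  choose a b hab hb ha hsign using hstep
  have hex : ∀ j, ∃ m, a j ≤ m ∧ m < b j ∧
      (j ≤ v + 1 → 0 < -ε * (-1) ^ j * ((X - C η) * g).coeff m) := by
    intro j
    by_cases hj : j ≤ v + 1
    · obtain ⟨m, h1, h2, h3⟩ :=
        exists_pos_sub (G := fun m => ε * (-1) ^ j * G m) (hab j).le (hsign j hj)
      refine ⟨m, h1, h2, fun _ => pos_of_mul_pos_right (a := η ^ m) ?_ (pow_pos hη m).le⟩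
      rw [← mul_sub, hGsub] at h3
      linarith
    · exact ⟨a j, le_rfl, hab j, fun h => absurd h hj⟩
  choose m hm1 hm2 hm3 using hex
  refine ⟨-ε, m, fun j hj => ?_, hm3⟩
  have h1 := hm2 j
  have h2 := hm1 (j + 1)
  rw [hb j (by omega)] at h1
  rw [ha (j + 1) (by omega) (by omega), Nat.add_sub_cancel] at h2
  omega

/-- The **Descartes rule of signs** for distinct positive roots. -/
theorem of_roots (hf : f ≠ 0) (S : Finset ℝ) (hS : ∀ x ∈ S, 0 < x ∧ f.IsRoot x) :
    HasAlternation f S.card := by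
  induction S using Finset.induction_on generalizing f with
  | empty =>
    refine ⟨f.leadingCoeff, fun _ => f.natDegree, by simp, fun j hj => ?_⟩
    obtain rfl : j = 0 := by simpa using hj
    simpa using hf
  | insert x S hx ih =>
    obtain ⟨hx0, hxf⟩ := hS x (by simp)
    obtain ⟨g, rfl⟩ := dvd_iff_isRoot.mpr hxf
    rw [Finset.card_insert_of_notMem hx]
    refine X_sub_C_mul hx0 (ih (right_ne_zero_of_mul hf) fun y hy => ?_)
    obtain ⟨hy0, hyf⟩ := hS y (by simp [hy])
    refine ⟨hy0, ?_⟩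
    rcases root_mul.mp hyf with h | h
    · rw [root_X_sub_C] at h
      exact absurd (h ▸ hy) hx
    · exact h

end HasAlternation

/-- The product of the first `m` odd numbers. -/
noncomputable def oddProd (m : ℕ) : ℝ := ∏ i ∈ range m, (2 * (i : ℝ) + 1)

theorem oddProd_pos (m : ℕ) : 0 < oddProd m := prod_pos fun _ _ => by positivity

theorem oddProd_mul_prod_range (k j : ℕ) :
    oddProd k * ∏ i ∈ range j, (2 * (k : ℝ) + 2 * (i : ℝ) + 1) = oddProd (k + j) := by
  rw [oddProd, oddProd, prod_range_add]
  congr 1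
  refine prod_congr rfl fun i _ => ?_
  push_cast
  ring

theorem oddProd_mul_prod_Icc {r k n j : ℕ} (hr : k + n < r) (hj : j ≤ n) :
    oddProd (r - (k + n) - 1) * ∏ i ∈ Icc j n, (2 * ((r : ℝ) - (k : ℝ) - (i : ℝ)) - 1)
      = oddProd (r - (k + j)) := by
  induction hj using Nat.decreasingInduction with
  | self =>
    obtain ⟨d, rfl⟩ := Nat.exists_eq_add_of_lt hr
    rw [show k + n + d + 1 - (k + n) - 1 = d by omega,
      show k + n + d + 1 - (k + n) = d + 1 by omega, Icc_self, prod_singleton, oddProd, oddProd,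
      prod_range_succ]
    push_cast
    ring
  | of_succ j hj ih =>
    obtain ⟨d, rfl⟩ := Nat.exists_eq_add_of_lt (show k + j < r by omega)
    rw [← mul_prod_Ioc_eq_prod_Icc hj.le, ← Icc_add_one_left_eq_Ioc, mul_left_comm,
      ih, show k + j + d + 1 - (k + (j + 1)) = d by omega,
      show k + j + d + 1 - (k + j) = d + 1 by omega, oddProd, oddProd, prod_range_succ]
    push_cast
    ring

open Polynomial in
/-- If `b k j` is, up to positive factors depending on `k` only and on `j + k` only, the binomial
coefficient `n.choose j`, then the polynomials `∑ j, b k j * X ^ (j + k)`, `k < s`, form a Chebyshev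
system on the positive half-line. -/
theorem eq_zero_of_binomial_combination_vanishes {n s : ℕ} {b : ℕ → ℕ → ℝ} {u w : ℕ → ℝ}
    (hu : ∀ k, 0 < u k) (hw : ∀ m, 0 < w m)
    (hb : ∀ k < s, ∀ j ≤ n, b k j = w (j + k) * ((n.choose j : ℝ) * u k))
    {c : ℕ → ℝ} {t : Fin s → ℝ} (ht : Function.Injective t) (hpos : ∀ i, 0 < t i)
    (hzero : ∀ i, ∑ k ∈ range s, c k * ∑ j ∈ range (n + 1), b k j * t i ^ (j + k) = 0) :
    ∀ k < s, c k = 0 := by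
  set f : ℝ[X] := ∑ k ∈ range s, ∑ j ∈ range (n + 1), monomial (j + k) (c k * b k j) with hf
  set p : ℝ[X] := ∑ k ∈ range s, monomial k (c k * u k) with hp
  have hq : (1 + X) ^ n * p =
      ∑ k ∈ range s, ∑ j ∈ range (n + 1), monomial (j + k) ((n.choose j : ℝ) * (c k * u k)) := by
    rw [hp, mul_sum]
    refine sum_congr rfl fun k _ => ?_
    rw [add_comm, add_pow, sum_mul]
    refine sum_congr rfl fun j _ => ?_
    rw [one_pow, mul_one, ← monomial_mul_monomial, X_pow_eq_monomial, ← C_eq_natCast,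
      monomial_mul_C, one_mul]
  have hcoeff : ∀ m, f.coeff m = w m * ((1 + X) ^ n * p).coeff m := by
    intro m
    rw [hq, hf]
    simp only [finsetSum_coeff, coeff_monomial, mul_sum]
    refine sum_congr rfl fun k hk => sum_congr rfl fun j hj => ?_
    split_ifs with hm
    · rw [hb k (mem_range.mp hk) j (Nat.lt_succ_iff.mp (mem_range.mp hj)), ← hm]
      ring
    · simp
  have hpc : ∀ k < s, p.coeff k = c k * u k := by
    intro k hk
    simp [hp, coeff_monomial, hk]
  by_cases hp0 : p = 0
  · intro k hk
    have := hpc k hk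
    rw [hp0, coeff_zero, eq_comm, mul_eq_zero] at this
    exact this.resolve_right (hu k).ne'
  exfalso
  have hdeg : p.natDegree < s := by
    rw [natDegree_lt_iff_degree_lt hp0, degree_lt_iff_coeff_zero]
    intro m hm
    rw [hp, finsetSum_coeff]
    refine sum_eq_zero fun k hk => coeff_monomial_of_ne _ ?_
    have := mem_range.mp hk
    omega
  have hf0 : f ≠ 0 := by
    intro h0
    have hX : (1 + X : ℝ[X]) ≠ 0 := by
      rw [add_comm, ← C_1]
      exact X_add_C_ne_zero 1
    refine mul_ne_zero (pow_ne_zero n hX) hp0 (Polynomial.ext fun m => ?_)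
    have := hcoeff m
    rw [h0, coeff_zero, eq_comm, mul_eq_zero] at this
    exact this.resolve_left (hw m).ne'
  have halt := HasAlternation.of_roots hf0 (univ.image t) (by
    intro x hx
    obtain ⟨i, -, rfl⟩ := mem_image.mp hx
    refine ⟨hpos i, ?_⟩
    rw [IsRoot.def, hf, eval_finsetSum, ← hzero i]
    refine sum_congr rfl fun k _ => ?_
    rw [eval_finsetSum, mul_sum]
    refine sum_congr rfl fun j _ => ?_
    rw [eval_monomial, mul_assoc])
  rw [card_image_of_injective _ ht, card_univ, Fintype.card_fin] at halt
  have := (halt.of_coeff_eq_mul hw hcoeff).of_one_add_X_pow_mul.le_natDegree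
  omega

/-- With `r > s > 0`,
`a_{k,j} = C(r-s,j) ∏_{i=0}^{j}(2k+2i+1) ∏_{i=j}^{r-s}(2(r-k-i)-1)` and
`h_k(t) = ∑_{j=0}^{r-s} a_{k,j} t^{j+k}`, the family `{h₀,…,h_{s-1}}` is a Chebyshev
system on `(0,1)`: any linear combination vanishing at `s` distinct points of `(0,1)`
is trivial; equivalently the collocation matrix at any `s` distinct points of `(0,1)`
is invertible. -/
theorem statement9 (r s : ℕ) (hs : 0 < s) (hrs : s < r)
    (a : ℕ → ℕ → ℝ)
    (ha : ∀ k j, a k j = (Nat.choose (r - s) j : ℝ)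
      * (∏ i ∈ Finset.range (j + 1), (2 * (k : ℝ) + 2 * (i : ℝ) + 1))
      * ∏ i ∈ Finset.Icc j (r - s), (2 * ((r : ℝ) - (k : ℝ) - (i : ℝ)) - 1))
    (h : ℕ → ℝ → ℝ)
    (hh : ∀ k t, h k t = ∑ j ∈ Finset.range (r - s + 1), a k j * t ^ (j + k)) :
    (∀ (c : ℕ → ℝ) (t : Fin s → ℝ), Function.Injective t →
      (∀ i, t i ∈ Set.Ioo (0 : ℝ) 1) →
      (∀ i, ∑ k ∈ Finset.range s, c k * h k (t i) = 0) →
      ∀ k < s, c k = 0)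
    ∧ ∀ t : Fin s → ℝ, Function.Injective t → (∀ i, t i ∈ Set.Ioo (0 : ℝ) 1) →
        (Matrix.of fun j k : Fin s => h (j : ℕ) (t k)).det ≠ 0 := by
  have main : ∀ (c : ℕ → ℝ) (t : Fin s → ℝ), Function.Injective t →
      (∀ i, t i ∈ Set.Ioo (0 : ℝ) 1) →
      (∀ i, ∑ k ∈ Finset.range s, c k * h k (t i) = 0) →
      ∀ k < s, c k = 0 := by
    intro c t ht hmem hzero
    refine eq_zero_of_binomial_combination_vanishes (n := r - s) (b := a)
      (u := fun k => (oddProd k * oddProd (s - k - 1))⁻¹)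
      (w := fun m => oddProd (m + 1) * oddProd (r - m))
      (fun k => inv_pos.mpr (mul_pos (oddProd_pos _) (oddProd_pos _)))
      (fun m => mul_pos (oddProd_pos _) (oddProd_pos _)) ?_ ht (fun i => (hmem i).1)
      (by simpa only [hh] using hzero)
    intro k hk j hj
    have h1 := oddProd_mul_prod_range k (j + 1)
    have h2 := oddProd_mul_prod_Icc (r := r) (k := k) (by omega) hj
    rw [show r - (k + (r - s)) - 1 = s - k - 1 by omega] at h2
    have hk0 := (oddProd_pos k).ne'
    have hsk0 := (oddProd_pos (s - k - 1)).ne'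
    rw [ha, add_comm j k, add_assoc, ← h1, ← h2]
    field_simp
  refine ⟨main, fun t ht hmem hdet => ?_⟩
  obtain ⟨v, hv, hvM⟩ := Matrix.exists_vecMul_eq_zero_iff.mpr hdet
  refine hv (funext fun k => ?_)
  have := main (fun k => if hk : k < s then v ⟨k, hk⟩ else 0) t ht hmem (fun i => by
    rw [Finset.sum_range]
    simpa [Matrix.vecMul, dotProduct] using congrFun hvM i) k k.2
  simpa using this
end
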